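/- There exists a unique Borel probability measure F* on [0, A] that achieves the information-energy capacity, i.e., F* ∈ Ω, I(F*) = C = sup_{F ∈ Ω} I(F), and any F ∈ Ω with I(F) = C equals F* (assuming Ω is nonempty). -/

import Mathlib

open MeasureTheory Real Set Filter

/-- Phase-removed Rayleigh-fading channel density `p(y|x)`. -/
noncomputable def pcond (x y : ℝ) : ℝ := (1 / (1 + x ^ 2)) * Real.exp (-y / (1 + x ^ 2))

/-- Modified Bessel function of the first kind, order zero. -/
noncomputable def besselI0 (t : ℝ) : ℝ := ∑' n : ℕ, (t ^ 2 / 4) ^ n / ((Nat.factorial n : ℝ)) ^ 2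

/-- Harvested-energy function `ℰ(x) = I₀(√2 B h₂ x)`. -/
noncomputable def EH (B h2 x : ℝ) : ℝ := besselI0 (Real.sqrt 2 * B * h2 * x)

/-- Output density `p(y; F)`. -/
noncomputable def pout (F : Measure ℝ) (y : ℝ) : ℝ := ∫ x, pcond x y ∂F

/-- Mutual-information density `i(x; F)`. -/
noncomputable def idens (F : Measure ℝ) (x : ℝ) : ℝ :=
  ∫ y in Set.Ioi (0 : ℝ), pcond x y * Real.log (pcond x y / pout F y)

/-- Mutual information `I(F)`. -/
noncomputable def MI (F : Measure ℝ) : ℝ := ∫ x, idens F x ∂F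

/-- Borel probability measure concentrated on `[0, A]`. -/
def IsDistOn (A : ℝ) (F : Measure ℝ) : Prop :=
  IsProbabilityMeasure F ∧ F (Set.Icc 0 A)ᶜ = 0

/-- The feasible set `Ω`: probability measures on `[0,A]` meeting the AP and EH constraints. -/
def Feas (A P B h2 Ereq : ℝ) (F : Measure ℝ) : Prop :=
  IsDistOn A F ∧ (∫ x, x ^ 2 ∂F) ≤ P ∧ Ereq ≤ ∫ x, EH B h2 x ∂F

/-- Information-energy capacity `C = sup_{F ∈ Ω} I(F)`. -/
noncomputable def Cap (A P B h2 Ereq : ℝ) : ℝ :=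
  sSup (MI '' {F | Feas A P B h2 Ereq F})

/-- Topological support of a measure: points all of whose open neighborhoods have
positive measure (the smallest closed set of full measure). -/
def msupp {X : Type*} [TopologicalSpace X] [MeasurableSpace X] (μ : Measure X) : Set X :=
  {x | ∀ U : Set X, IsOpen U → x ∈ U → 0 < μ U}

/-- The interval containing every output density value at `y`, when `1 + x² ≤ M`. -/
def densityRange (M y : ℝ) : Set ℝ := Icc (Real.exp (-y) / M) (Real.exp (-y / M))

/-- An integrable envelope for the entropy integrands. -/
noncomputable def entropyEnvelope (M y : ℝ) : ℝ := Real.exp (-y / M) * (y + Real.log M)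

lemma pos_of_mem_densityRange {M y v : ℝ} (hM : 1 ≤ M) (hv : v ∈ densityRange M y) : 0 < v := by
  have : 0 < Real.exp (-y) / M := by positivity
  exact this.trans_le hv.1

lemma abs_log_le_of_mem_densityRange {M y v : ℝ} (hM : 1 ≤ M) (hy : 0 < y)
    (hv : v ∈ densityRange M y) : |Real.log v| ≤ y + Real.log M := by
  have hv0 := pos_of_mem_densityRange hM hv
  have hlogM : 0 ≤ Real.log M := Real.log_nonneg hM
  have h1 : Real.log (Real.exp (-y) / M) ≤ Real.log v := Real.log_le_log (by positivity) hv.1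
  rw [Real.log_div (Real.exp_ne_zero _) (by positivity), Real.log_exp] at h1
  have h2 : Real.log v ≤ Real.log (Real.exp (-y / M)) := Real.log_le_log hv0 hv.2
  rw [Real.log_exp] at h2
  have h3 : -y / M ≤ 0 := div_nonpos_of_nonpos_of_nonneg (by linarith) (by linarith)
  rw [abs_le]
  constructor <;> linarith

lemma abs_mul_log_le_entropyEnvelope {M y v w : ℝ} (hM : 1 ≤ M) (hy : 0 < y)
    (hv : v ∈ densityRange M y) (hw : w ∈ densityRange M y) :
    |v * Real.log w| ≤ entropyEnvelope M y := by
  rw [abs_mul, abs_of_pos (pos_of_mem_densityRange hM hv)]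
  exact mul_le_mul hv.2 (abs_log_le_of_mem_densityRange hM hy hw) (abs_nonneg _)
    (Real.exp_pos _).le

lemma integrableOn_entropyEnvelope {M : ℝ} (hM : 1 ≤ M) :
    IntegrableOn (entropyEnvelope M) (Ioi 0) := by
  have hM0 : 0 < M⁻¹ := by positivity
  have h1 := integrableOn_rpow_mul_exp_neg_mul_rpow (s := 1) (p := 1) (by norm_num) one_pos hM0
  have h2 := (integrableOn_rpow_mul_exp_neg_mul_rpow (s := 0) (p := 1) (by norm_num) one_pos
    hM0).mul_const (Real.log M)
  refine (h1.add h2).congr (Eventually.of_forall fun y => ?_)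
  simp only [Pi.add_apply, Real.rpow_one, Real.rpow_zero, entropyEnvelope]
  rw [show -M⁻¹ * y = -y / M by ring]
  ring

lemma continuous_uncurry_pcond : Continuous (Function.uncurry pcond) := by
  have h (p : ℝ × ℝ) : 1 + p.1 ^ 2 ≠ 0 := by positivity
  unfold Function.uncurry pcond
  fun_prop (disch := exact h)

lemma continuous_pcond_left (y : ℝ) : Continuous fun x => pcond x y :=
  continuous_uncurry_pcond.comp (continuous_id.prodMk continuous_const)

lemma continuous_pcond_right (x : ℝ) : Continuous (pcond x) :=
  continuous_uncurry_pcond.comp (continuous_const.prodMk continuous_id)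

lemma pcond_mem_densityRange {A x y : ℝ} (hx : x ∈ Icc 0 A) (hy : 0 < y) :
    pcond x y ∈ densityRange (1 + A ^ 2) y := by
  have hxA : x ^ 2 ≤ A ^ 2 := pow_le_pow_left₀ hx.1 hx.2 2
  have hx2 : 0 ≤ x ^ 2 := sq_nonneg x
  constructor
  · rw [pcond, div_eq_inv_mul, ← one_div]
    have : -y ≤ -y / (1 + x ^ 2) := by
      rw [le_div_iff₀ (by positivity)]
      nlinarith
    gcongr
  · have h1 : 1 / (1 + x ^ 2) ≤ 1 := by
      rw [div_le_one (by positivity)]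
      linarith
    have h2 : -y / (1 + x ^ 2) ≤ -y / (1 + A ^ 2) := by
      rw [neg_div, neg_div, neg_le_neg_iff]
      gcongr
    calc pcond x y ≤ 1 * Real.exp (-y / (1 + A ^ 2)) := by
          unfold pcond
          gcongr
      _ = _ := one_mul _

section CompactInput

variable {A : ℝ}

lemma one_le_one_add_sq (A : ℝ) : 1 ≤ 1 + A ^ 2 := by nlinarith [sq_nonneg A]

/-- Output density of an input distribution on the compact interval `[0, A]`. -/
noncomputable def outDensity (μ : Measure (Icc (0 : ℝ) A)) (y : ℝ) : ℝ := ∫ x, pcond x y ∂μ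

/-- Input-dependent part of the mutual information. -/
noncomputable def negCondEntropy (x : Icc (0 : ℝ) A) : ℝ :=
  ∫ y in Ioi (0 : ℝ), pcond x y * Real.log (pcond x y)

/-- Differential entropy of the output. -/
noncomputable def outEntropy (μ : Measure (Icc (0 : ℝ) A)) : ℝ :=
  ∫ y in Ioi (0 : ℝ), Real.negMulLog (outDensity μ y)

lemma integrable_of_continuous (μ : Measure (Icc (0 : ℝ) A)) [IsFiniteMeasure μ]
    {f : Icc (0 : ℝ) A → ℝ} (hf : Continuous f) : Integrable f μ :=
  (BoundedContinuousFunction.mkOfCompact ⟨f, hf⟩).integrable μ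

lemma continuous_pcond_subtype (y : ℝ) : Continuous fun x : Icc (0 : ℝ) A => pcond x y :=
  (continuous_pcond_left y).comp continuous_subtype_val

lemma integrable_pcond (μ : Measure (Icc (0 : ℝ) A)) [IsFiniteMeasure μ] (y : ℝ) :
    Integrable (fun x : Icc (0 : ℝ) A => pcond x y) μ :=
  integrable_of_continuous μ (continuous_pcond_subtype y)

lemma continuous_outDensity (μ : Measure (Icc (0 : ℝ) A)) [IsFiniteMeasure μ] :
    Continuous (outDensity μ) := by
  have h : Continuous (Function.uncurry fun (y : ℝ) (x : Icc (0 : ℝ) A) => pcond x y) :=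
    continuous_uncurry_pcond.comp
      ((continuous_subtype_val.comp continuous_snd).prodMk continuous_fst)
  have := continuous_parametric_integral_of_continuous (μ := μ) h isCompact_univ
  rw [Measure.restrict_univ] at this
  exact this

lemma outDensity_mem_densityRange (μ : Measure (Icc (0 : ℝ) A)) [IsProbabilityMeasure μ] {y : ℝ}
    (hy : 0 < y) : outDensity μ y ∈ densityRange (1 + A ^ 2) y := by
  have hmem (x : Icc (0 : ℝ) A) := pcond_mem_densityRange x.2 hy
  constructor
  · simpa [outDensity] using integral_mono (integrable_const (Real.exp (-y) / (1 + A ^ 2)))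
      (integrable_pcond μ y) fun x => (hmem x).1
  · simpa [outDensity] using integral_mono (integrable_pcond μ y)
      (integrable_const (Real.exp (-y / (1 + A ^ 2)))) fun x => (hmem x).2

lemma abs_negMulLog_outDensity_le (μ : Measure (Icc (0 : ℝ) A)) [IsProbabilityMeasure μ] {y : ℝ}
    (hy : 0 < y) : |Real.negMulLog (outDensity μ y)| ≤ entropyEnvelope (1 + A ^ 2) y := by
  have h := outDensity_mem_densityRange μ hy
  rw [Real.negMulLog, neg_mul, abs_neg]
  exact abs_mul_log_le_entropyEnvelope (one_le_one_add_sq A) hy h h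

lemma integrableOn_negMulLog_outDensity (μ : Measure (Icc (0 : ℝ) A)) [IsProbabilityMeasure μ] :
    IntegrableOn (fun y => Real.negMulLog (outDensity μ y)) (Ioi 0) := by
  refine Integrable.mono' (integrableOn_entropyEnvelope (one_le_one_add_sq A))
    (Real.continuous_negMulLog.comp (continuous_outDensity μ)).aestronglyMeasurable ?_
  filter_upwards [ae_restrict_mem measurableSet_Ioi] with y hy
  exact abs_negMulLog_outDensity_le μ hy

lemma integrableOn_pcond_mul_log_pcond (x : Icc (0 : ℝ) A) :
    IntegrableOn (fun y => pcond x y * Real.log (pcond x y)) (Ioi 0) := by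
  refine Integrable.mono' (integrableOn_entropyEnvelope (one_le_one_add_sq A))
    (continuous_pcond_right x).mul_log.aestronglyMeasurable ?_
  filter_upwards [ae_restrict_mem measurableSet_Ioi] with y hy
  have h := pcond_mem_densityRange x.2 hy
  exact abs_mul_log_le_entropyEnvelope (one_le_one_add_sq A) hy h h

lemma integrable_pcond_mul_log_outDensity (μ : Measure (Icc (0 : ℝ) A)) [IsProbabilityMeasure μ] :
    Integrable (Function.uncurry fun (x : Icc (0 : ℝ) A) (y : ℝ) =>
      pcond x y * Real.log (outDensity μ y)) (μ.prod (volume.restrict (Ioi 0))) := by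
  have henv : Integrable (entropyEnvelope (1 + A ^ 2)) (volume.restrict (Ioi 0)) :=
    integrableOn_entropyEnvelope (one_le_one_add_sq A)
  refine Integrable.mono' (henv.comp_snd μ) (Measurable.aestronglyMeasurable ?_) ?_
  · have h1 : Measurable fun p : Icc (0 : ℝ) A × ℝ => pcond p.1 p.2 :=
      (continuous_uncurry_pcond.comp
        ((continuous_subtype_val.comp continuous_fst).prodMk continuous_snd)).measurable
    exact h1.mul
      (Real.measurable_log.comp ((continuous_outDensity μ).measurable.comp measurable_snd))
  · have h : ∀ᵐ p ∂(μ.prod (volume.restrict (Ioi (0 : ℝ)))), p.2 ∈ Ioi (0 : ℝ) :=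
      Measure.quasiMeasurePreserving_snd.ae (ae_restrict_mem measurableSet_Ioi)
    filter_upwards [h] with p hp
    exact abs_mul_log_le_entropyEnvelope (one_le_one_add_sq A) hp
      (pcond_mem_densityRange p.1.2 hp) (outDensity_mem_densityRange μ hp)

lemma integrableOn_pcond_mul_log_outDensity (μ : Measure (Icc (0 : ℝ) A)) [IsProbabilityMeasure μ]
    (x : Icc (0 : ℝ) A) :
    IntegrableOn (fun y => pcond x y * Real.log (outDensity μ y)) (Ioi 0) := by
  refine Integrable.mono' (integrableOn_entropyEnvelope (one_le_one_add_sq A))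
    ((continuous_pcond_right x).measurable.mul
      (Real.measurable_log.comp (continuous_outDensity μ).measurable)).aestronglyMeasurable ?_
  filter_upwards [ae_restrict_mem measurableSet_Ioi] with y hy
  exact abs_mul_log_le_entropyEnvelope (one_le_one_add_sq A) hy
    (pcond_mem_densityRange x.2 hy) (outDensity_mem_densityRange μ hy)

lemma continuous_negCondEntropy : Continuous (negCondEntropy (A := A)) := by
  refine continuous_of_dominated (bound := entropyEnvelope (1 + A ^ 2))
    (fun x => (continuous_pcond_right x).mul_log.aestronglyMeasurable) (fun x => ?_)
    (integrableOn_entropyEnvelope (one_le_one_add_sq A))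
    (Eventually.of_forall fun y => (continuous_pcond_subtype y).mul_log)
  filter_upwards [ae_restrict_mem measurableSet_Ioi] with y hy
  have h := pcond_mem_densityRange x.2 hy
  exact abs_mul_log_le_entropyEnvelope (one_le_one_add_sq A) hy h h

lemma integral_map_val (μ : Measure (Icc (0 : ℝ) A)) (f : ℝ → ℝ) :
    ∫ x, f x ∂(μ.map Subtype.val) = ∫ x : Icc (0 : ℝ) A, f x ∂μ :=
  (MeasurableEmbedding.subtype_coe measurableSet_Icc).integral_map f

lemma pout_map_val (μ : Measure (Icc (0 : ℝ) A)) :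
    pout (μ.map Subtype.val) = outDensity μ :=
  funext fun y => integral_map_val μ (pcond · y)

lemma MI_map_val (μ : Measure (Icc (0 : ℝ) A)) [IsProbabilityMeasure μ] :
    MI (μ.map Subtype.val) = ∫ x, negCondEntropy x ∂μ + outEntropy μ := by
  have hi (x : Icc (0 : ℝ) A) : idens (μ.map Subtype.val) x =
      negCondEntropy x - ∫ y in Ioi (0 : ℝ), pcond x y * Real.log (outDensity μ y) := by
    rw [idens, negCondEntropy, pout_map_val, ← integral_sub (integrableOn_pcond_mul_log_pcond x)
      (integrableOn_pcond_mul_log_outDensity μ x)]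
    refine setIntegral_congr_fun measurableSet_Ioi fun y hy => ?_
    have h1 := pos_of_mem_densityRange (one_le_one_add_sq A) (pcond_mem_densityRange x.2 hy)
    have h2 := pos_of_mem_densityRange (one_le_one_add_sq A) (outDensity_mem_densityRange μ hy)
    simp only [Real.log_div h1.ne' h2.ne']
    ring
  have hprod := integrable_pcond_mul_log_outDensity μ
  rw [MI, integral_map_val]
  simp_rw [hi]
  rw [integral_sub (integrable_of_continuous μ continuous_negCondEntropy)
    (by exact hprod.integral_prod_left), integral_integral_swap hprod, sub_eq_add_neg,
    ← integral_neg, outEntropy]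
  congr 1
  refine integral_congr_ae (Eventually.of_forall fun y => ?_)
  simp only [integral_mul_const, Real.negMulLog, neg_mul, outDensity]

lemma continuous_integral_probabilityMeasure {f : Icc (0 : ℝ) A → ℝ} (hf : Continuous f) :
    Continuous fun μ : ProbabilityMeasure (Icc (0 : ℝ) A) =>
      ∫ x, f x ∂(μ : Measure (Icc (0 : ℝ) A)) :=
  ProbabilityMeasure.continuous_integral_boundedContinuousFunction
    (BoundedContinuousFunction.mkOfCompact ⟨f, hf⟩)

lemma continuous_outEntropy :
    Continuous fun μ : ProbabilityMeasure (Icc (0 : ℝ) A) =>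
      outEntropy (μ : Measure (Icc (0 : ℝ) A)) := by
  refine continuous_of_dominated (bound := entropyEnvelope (1 + A ^ 2))
    (fun μ => (integrableOn_negMulLog_outDensity (μ : Measure (Icc (0 : ℝ) A))).aestronglyMeasurable)
    (fun μ => ?_) (integrableOn_entropyEnvelope (one_le_one_add_sq A))
    (Eventually.of_forall fun y => Real.continuous_negMulLog.comp
      (continuous_integral_probabilityMeasure (continuous_pcond_subtype y)))
  filter_upwards [ae_restrict_mem measurableSet_Ioi] with y hy
  exact abs_negMulLog_outDensity_le (μ : Measure (Icc (0 : ℝ) A)) hy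

lemma continuous_EH_subtype (B h2 : ℝ) : Continuous fun x : Icc (0 : ℝ) A => EH B h2 x := by
  set c := √2 * B * h2
  have hbound : Summable fun n : ℕ => ((c * A) ^ 2 / 4) ^ n / (n.factorial : ℝ) :=
    Real.summable_pow_div_factorial _
  refine continuous_tsum (fun n => by fun_prop) hbound fun n x => ?_
  have hx : (x : ℝ) ^ 2 ≤ A ^ 2 := pow_le_pow_left₀ x.2.1 x.2.2 2
  have hcx : (c * (x : ℝ)) ^ 2 ≤ (c * A) ^ 2 := by
    rw [mul_pow c, mul_pow c]
    exact mul_le_mul_of_nonneg_left hx (sq_nonneg c)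
  have hfac : (1 : ℝ) ≤ n.factorial := by exact_mod_cast n.factorial_pos
  rw [Real.norm_of_nonneg (by positivity)]
  have hfac2 : (n.factorial : ℝ) ≤ (n.factorial : ℝ) ^ 2 := by nlinarith
  exact div_le_div₀ (by positivity) (pow_le_pow_left₀ (by positivity) (by linarith) n)
    (by positivity) hfac2

/-- The output density on `(0, ∞)` determines the input distribution. -/
lemma measure_eq_of_outDensity_eqOn {μ ν : Measure (Icc (0 : ℝ) A)} [IsFiniteMeasure μ]
    [IsFiniteMeasure ν] (h : EqOn (outDensity μ) (outDensity ν) (Ioi 0)) : μ = ν := by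
  let w : C(Icc (0 : ℝ) A, ℝ) := ⟨fun x => pcond x 1, continuous_pcond_subtype 1⟩
  have hu : Continuous fun x : Icc (0 : ℝ) A => Real.exp (-1 / (1 + (x : ℝ) ^ 2)) := by
    have h (x : Icc (0 : ℝ) A) : 1 + (x : ℝ) ^ 2 ≠ 0 := by positivity
    fun_prop (disch := exact h)
  let t : C(Icc (0 : ℝ) A, ℝ) := ⟨_, hu⟩
  have hcont (ρ : Measure (Icc (0 : ℝ) A)) [IsFiniteMeasure ρ] :
      Continuous fun f : C(Icc (0 : ℝ) A, ℝ) => ∫ x, w x * f x ∂ρ := by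
    have : Continuous fun f : C(Icc (0 : ℝ) A, ℝ) => ∫ x, f x ∂ρ := by
      let L : C(Icc (0 : ℝ) A, ℝ) →ₗ[ℝ] ℝ :=
        { toFun := fun f => ∫ x, f x ∂ρ
          map_add' := fun f g => integral_add (integrable_of_continuous ρ f.continuous)
            (integrable_of_continuous ρ g.continuous)
          map_smul' := fun c f => integral_const_mul c f }
      refine (L.mkContinuous (ρ.real univ) fun f => ?_).continuous
      rw [mul_comm]
      exact norm_integral_le_of_norm_le_const (Eventually.of_forall f.norm_coe_le_norm)
    exact this.comp (continuous_const.mul continuous_id (f := fun _ => w))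
  have hclosed : IsClosed {f : C(Icc (0 : ℝ) A, ℝ) | ∫ x, w x * f x ∂μ = ∫ x, w x * f x ∂ν} :=
    isClosed_eq (hcont μ) (hcont ν)
  have hint (ρ : Measure (Icc (0 : ℝ) A)) [IsFiniteMeasure ρ] (f : C(Icc (0 : ℝ) A, ℝ)) :
      Integrable (fun x => w x * f x) ρ :=
    integrable_of_continuous ρ (w.continuous.mul f.continuous)
  have hpoly (p : Polynomial ℝ) :
      ∫ x, w x * Polynomial.aeval t p x ∂μ = ∫ x, w x * Polynomial.aeval t p x ∂ν := by
    induction p using Polynomial.induction_on' with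
    | add p q hp hq =>
      simp only [map_add, ContinuousMap.add_apply, mul_add]
      rw [integral_add (hint μ _) (hint μ _), integral_add (hint ν _) (hint ν _), hp, hq]
    | monomial n a =>
      have key (x : Icc (0 : ℝ) A) :
          w x * Polynomial.aeval t (Polynomial.monomial n a) x = a * pcond x (n + 1) := by
        simp only [Polynomial.aeval_monomial, ContinuousMap.mul_apply, ContinuousMap.pow_apply,
          algebraMap_apply, w, t, ContinuousMap.coe_mk, pcond, ← Real.exp_nat_mul,
          smul_eq_mul, mul_one]
        rw [show -((n : ℝ) + 1) / (1 + (x : ℝ) ^ 2) =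
          -1 / (1 + (x : ℝ) ^ 2) + n * (-1 / (1 + (x : ℝ) ^ 2)) by ring, Real.exp_add]
        ring
      simp only [key, integral_const_mul]
      congr 1
      exact h (mem_Ioi.2 (by positivity))
  have hsep : (Algebra.adjoin ℝ {t}).SeparatesPoints := by
    intro x y hxy
    refine ⟨t, ⟨t, Algebra.self_mem_adjoin_singleton ℝ t, rfl⟩, fun heq => hxy ?_⟩
    have h1 : -1 / (1 + (x : ℝ) ^ 2) = -1 / (1 + (y : ℝ) ^ 2) := Real.exp_injective heq
    have h2 : (x : ℝ) ^ 2 = (y : ℝ) ^ 2 := by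
      rw [div_eq_div_iff (by positivity) (by positivity)] at h1
      linarith
    exact Subtype.ext ((pow_left_inj₀ x.2.1 y.2.1 two_ne_zero).1 h2)
  have hall (f : C(Icc (0 : ℝ) A, ℝ)) : ∫ x, w x * f x ∂μ = ∫ x, w x * f x ∂ν := by
    have hf : f ∈ (Algebra.adjoin ℝ {t}).topologicalClosure := by
      rw [ContinuousMap.subalgebra_topologicalClosure_eq_top_of_separatesPoints _ hsep]
      trivial
    refine closure_minimal (fun g hg => ?_) hclosed hf
    rw [SetLike.mem_coe, Algebra.adjoin_singleton_eq_range_aeval] at hg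
    obtain ⟨p, rfl⟩ := hg
    exact hpoly p
  have hw (x : Icc (0 : ℝ) A) : w x ≠ 0 :=
    (pos_of_mem_densityRange (one_le_one_add_sq A) (pcond_mem_densityRange x.2 one_pos)).ne'
  refine ext_of_forall_integral_eq_of_IsFiniteMeasure fun f => ?_
  have := hall ⟨fun x => f x / w x, f.continuous.div w.continuous hw⟩
  simpa only [ContinuousMap.coe_mk, mul_div_cancel₀ _ (hw _)] using this

/-- The average of two input distributions. -/
noncomputable def midMeasure (μ ν : Measure (Icc (0 : ℝ) A)) : Measure (Icc (0 : ℝ) A) :=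
  (2⁻¹ : ENNReal) • μ + (2⁻¹ : ENNReal) • ν

instance (μ ν : Measure (Icc (0 : ℝ) A)) [IsProbabilityMeasure μ] [IsProbabilityMeasure ν] :
    IsProbabilityMeasure (midMeasure μ ν) :=
  ⟨by simp [midMeasure, ENNReal.inv_two_add_inv_two]⟩

lemma integral_midMeasure (μ ν : Measure (Icc (0 : ℝ) A)) [IsFiniteMeasure μ]
    [IsFiniteMeasure ν] {f : Icc (0 : ℝ) A → ℝ} (hf : Continuous f) :
    ∫ x, f x ∂(midMeasure μ ν) = (∫ x, f x ∂μ + ∫ x, f x ∂ν) / 2 := by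
  rw [midMeasure, integral_add_measure
    ((integrable_of_continuous μ hf).smul_measure (by simp))
    ((integrable_of_continuous ν hf).smul_measure (by simp)), integral_smul_measure,
    integral_smul_measure]
  simp only [ENNReal.toReal_inv, ENNReal.toReal_ofNat, smul_eq_mul]
  ring

/-- Strict midpoint concavity of the output entropy. -/
lemma eq_of_outEntropy_midMeasure_le {μ ν : Measure (Icc (0 : ℝ) A)} [IsProbabilityMeasure μ]
    [IsProbabilityMeasure ν]
    (h : outEntropy (midMeasure μ ν) ≤ (outEntropy μ + outEntropy ν) / 2) : μ = ν := by
  have hmid (y : ℝ) : outDensity (midMeasure μ ν) y = (outDensity μ y + outDensity ν y) / 2 :=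
    integral_midMeasure μ ν (continuous_pcond_subtype y)
  have hpos (ρ : Measure (Icc (0 : ℝ) A)) [IsProbabilityMeasure ρ] {y : ℝ} (hy : 0 < y) :
      0 ≤ outDensity ρ y :=
    (pos_of_mem_densityRange (one_le_one_add_sq A) (outDensity_mem_densityRange ρ hy)).le
  set gap : ℝ → ℝ := fun y => Real.negMulLog (outDensity (midMeasure μ ν) y) -
    (Real.negMulLog (outDensity μ y) + Real.negMulLog (outDensity ν y)) / 2 with hgap
  have hI1 := integrableOn_negMulLog_outDensity (midMeasure μ ν)
  have hI2 := integrableOn_negMulLog_outDensity μ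
  have hI3 := integrableOn_negMulLog_outDensity ν
  have hI4 := (hI2.add hI3).div_const 2
  have hgap_int : IntegrableOn gap (Ioi 0) := hI1.sub hI4
  have hgap_nonneg : ∀ y ∈ Ioi (0 : ℝ), 0 ≤ gap y := by
    intro y hy
    have := Real.concaveOn_negMulLog.2 (hpos μ hy) (hpos ν hy)
      (by norm_num : (0 : ℝ) ≤ 1 / 2) (by norm_num : (0 : ℝ) ≤ 1 / 2) (by norm_num)
    simp only [smul_eq_mul] at this
    rw [hgap]
    simp only [hmid]
    rw [show (outDensity μ y + outDensity ν y) / 2 =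
      1 / 2 * outDensity μ y + 1 / 2 * outDensity ν y by ring]
    linarith
  have hgap_ae : 0 ≤ᵐ[volume.restrict (Ioi 0)] gap :=
    (ae_restrict_mem measurableSet_Ioi).mono hgap_nonneg
  have hval : ∫ y in Ioi 0, gap y = outEntropy (midMeasure μ ν) -
      (outEntropy μ + outEntropy ν) / 2 := by
    refine (integral_sub hI1 hI4).trans ?_
    rw [integral_div, integral_add' hI2 hI3]
    rfl
  have hzero : ∫ y in Ioi 0, gap y = 0 :=
    le_antisymm (by linarith) (integral_nonneg_of_ae hgap_ae)
  rw [integral_eq_zero_iff_of_nonneg_ae hgap_ae hgap_int] at hzero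
  refine measure_eq_of_outDensity_eqOn (Measure.eqOn_open_of_ae_eq (μ := volume) ?_ isOpen_Ioi
    (continuous_outDensity μ).continuousOn (continuous_outDensity ν).continuousOn)
  filter_upwards [hzero, ae_restrict_mem measurableSet_Ioi] with y hy0 hy
  by_contra hne
  have := Real.strictConcaveOn_negMulLog.2 (hpos μ hy) (hpos ν hy) hne
    (by norm_num : (0 : ℝ) < 1 / 2) (by norm_num : (0 : ℝ) < 1 / 2) (by norm_num)
  simp only [smul_eq_mul] at this
  simp only [hgap, hmid, Pi.zero_apply] at hy0
  rw [show (outDensity μ y + outDensity ν y) / 2 =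
    1 / 2 * outDensity μ y + 1 / 2 * outDensity ν y by ring] at hy0
  linarith

lemma isDistOn_map_val (μ : Measure (Icc (0 : ℝ) A)) [IsProbabilityMeasure μ] :
    IsDistOn A (μ.map Subtype.val) := by
  refine ⟨Measure.isProbabilityMeasure_map measurable_subtype_coe.aemeasurable, ?_⟩
  rw [Measure.map_apply measurable_subtype_coe measurableSet_Icc.compl]
  simp

lemma IsDistOn.exists_map_val_eq {F : Measure ℝ} (hF : IsDistOn A F) :
    ∃ μ : ProbabilityMeasure (Icc (0 : ℝ) A),
      (μ : Measure (Icc (0 : ℝ) A)).map Subtype.val = F := by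
  have hmap : (F.comap Subtype.val : Measure (Icc (0 : ℝ) A)).map Subtype.val = F := by
    rw [map_comap_subtype_coe measurableSet_Icc, Measure.restrict_eq_self_of_ae_mem]
    exact hF.2
  have hprob : IsProbabilityMeasure (F.comap Subtype.val : Measure (Icc (0 : ℝ) A)) := by
    constructor
    have := hF.1.measure_univ
    rw [← hmap, Measure.map_apply measurable_subtype_coe MeasurableSet.univ] at this
    simpa using this
  exact ⟨⟨_, hprob⟩, hmap⟩

lemma feas_map_val_iff {P B h2 Ereq : ℝ} (μ : Measure (Icc (0 : ℝ) A)) [IsProbabilityMeasure μ] :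
    Feas A P B h2 Ereq (μ.map Subtype.val) ↔
      ∫ x : Icc (0 : ℝ) A, (x : ℝ) ^ 2 ∂μ ≤ P ∧ Ereq ≤ ∫ x : Icc (0 : ℝ) A, EH B h2 x ∂μ := by
  rw [Feas, integral_map_val μ (· ^ 2), integral_map_val]
  exact and_iff_right (isDistOn_map_val μ)

end CompactInput

/-- There exists a unique Borel probability measure `F*` on `[0, A]`
achieving the information-energy capacity: `F* ∈ Ω`, `I(F*) = C = sup_{F ∈ Ω} I(F)`,
and any `F ∈ Ω` with `I(F) = C` equals `F*` (assuming `Ω` nonempty). -/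
theorem stmt0 (A P B h2 Ereq : ℝ) (hA : 0 < A) (hP : 0 < P) (hB : 0 < B) (hh2 : 0 < h2)
    (hne : ∃ F : Measure ℝ, Feas A P B h2 Ereq F) :
    ∃! Fstar : Measure ℝ,
      Feas A P B h2 Ereq Fstar ∧ MI Fstar = Cap A P B h2 Ereq := by
  have hsq : Continuous fun x : Icc (0 : ℝ) A => (x : ℝ) ^ 2 := by fun_prop
  have hEH : Continuous fun x : Icc (0 : ℝ) A => EH B h2 x := continuous_EH_subtype B h2
  let K : Set (ProbabilityMeasure (Icc (0 : ℝ) A)) :=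
    {μ | ∫ x : Icc (0 : ℝ) A, (x : ℝ) ^ 2 ∂(μ : Measure (Icc (0 : ℝ) A)) ≤ P ∧
      Ereq ≤ ∫ x : Icc (0 : ℝ) A, EH B h2 x ∂(μ : Measure (Icc (0 : ℝ) A))}
  have hK (μ : ProbabilityMeasure (Icc (0 : ℝ) A)) :
      Feas A P B h2 Ereq ((μ : Measure (Icc (0 : ℝ) A)).map Subtype.val) ↔ μ ∈ K :=
    feas_map_val_iff (μ : Measure (Icc (0 : ℝ) A))
  have hKcompact : IsCompact K :=
    ((isClosed_le (continuous_integral_probabilityMeasure hsq) continuous_const).inter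
      (isClosed_le continuous_const (continuous_integral_probabilityMeasure hEH))).isCompact
  have hKne : K.Nonempty := by
    obtain ⟨F, hF⟩ := hne
    obtain ⟨μ, rfl⟩ := hF.1.exists_map_val_eq
    exact ⟨μ, (hK μ).1 hF⟩
  have hcont : Continuous fun μ : ProbabilityMeasure (Icc (0 : ℝ) A) =>
      MI ((μ : Measure (Icc (0 : ℝ) A)).map Subtype.val) := by
    simp only [MI_map_val]
    exact (continuous_integral_probabilityMeasure continuous_negCondEntropy).add
      continuous_outEntropy
  obtain ⟨μ, hμ, hmax⟩ := hKcompact.exists_isMaxOn hKne hcont.continuousOn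
  have hle {F : Measure ℝ} (hF : Feas A P B h2 Ereq F) :
      MI F ≤ MI ((μ : Measure (Icc (0 : ℝ) A)).map Subtype.val) := by
    obtain ⟨ν, rfl⟩ := hF.1.exists_map_val_eq
    exact hmax ((hK ν).1 hF)
  have hCap : Cap A P B h2 Ereq = MI ((μ : Measure (Icc (0 : ℝ) A)).map Subtype.val) :=
    IsGreatest.csSup_eq ⟨⟨_, (hK μ).2 hμ, rfl⟩, by rintro _ ⟨F, hF, rfl⟩; exact hle hF⟩
  refine ⟨_, ⟨(hK μ).2 hμ, hCap.symm⟩, ?_⟩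
  rintro F ⟨hF, hFC⟩
  obtain ⟨ν, rfl⟩ := hF.1.exists_map_val_eq
  have hν := (hK ν).1 hF
  rw [hCap] at hFC
  have hmid : Feas A P B h2 Ereq
      ((midMeasure (ν : Measure (Icc (0 : ℝ) A)) (μ : Measure (Icc (0 : ℝ) A))).map
        Subtype.val) := by
    rw [feas_map_val_iff, integral_midMeasure _ _ hsq, integral_midMeasure _ _ hEH]
    constructor <;> linarith [hμ.1, hμ.2, hν.1, hν.2]
  have hmid_le := hle hmid
  rw [MI_map_val, MI_map_val] at hFC hmid_le
  rw [integral_midMeasure _ _ continuous_negCondEntropy] at hmid_le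
  rw [eq_of_outEntropy_midMeasure_le (μ := (ν : Measure (Icc (0 : ℝ) A)))
    (ν := (μ : Measure (Icc (0 : ℝ) A))) (by linarith)]
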